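/- Binet formula for the bi-periodic Fibonacci numbers: for every natural number n, F_n = (a^{ξ(n+1)}/(ab)^⌊n/2⌋)·(αⁿ − βⁿ)/(α − β), where ξ(n) = n − 2·⌊n/2⌋ (so ξ(n) = 0 when n is even and ξ(n) = 1 when n is odd). -/

import Mathlib

/-- The bi-periodic Fibonacci sequence: `F 0 = 0`, `F 1 = 1`, and
`F n = a * F (n-1) + F (n-2)` if `n` is even, `F n = b * F (n-1) + F (n-2)` if `n` is odd. -/
noncomputable def biF (a b : ℝ) : ℕ → ℝ
  | 0 => 0
  | 1 => 1
  | n + 2 => (if Even (n + 2) then a else b) * biF a b (n + 1) + biF a b n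

/-- The parity function `ξ(n) = n - 2⌊n/2⌋`, i.e. `0` if `n` is even and `1` if `n` is odd. -/
def xi (n : ℕ) : ℕ := n - 2 * (n / 2)

/-- Division-free Binet formulas for the terms of even and odd index, for arbitrary roots
`α`, `β` of `x ^ 2 = a * b * x + a * b`. -/
theorem biF_mul_sub (a b α β : ℝ) (hα : α ^ 2 = a * b * α + a * b)
    (hβ : β ^ 2 = a * b * β + a * b) (k : ℕ) :
    (a * b) ^ k * biF a b (2 * k) * (α - β) = a * (α ^ (2 * k) - β ^ (2 * k)) ∧
      (a * b) ^ k * biF a b (2 * k + 1) * (α - β) = α ^ (2 * k + 1) - β ^ (2 * k + 1) := by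
  induction k with
  | zero => simp [biF]
  | succ k ih =>
    obtain ⟨h_even, h_odd⟩ := ih
    have rec_even : biF a b (2 * k + 2) = a * biF a b (2 * k + 1) + biF a b (2 * k) := by
      rw [biF, if_pos (by grind)]
    have rec_odd : biF a b (2 * k + 3) = b * biF a b (2 * k + 2) + biF a b (2 * k + 1) := by
      rw [biF, if_neg (by grind)]
    have h_even' : (a * b) ^ (k + 1) * biF a b (2 * k + 2) * (α - β) =
        a * (α ^ (2 * k + 2) - β ^ (2 * k + 2)) := by
      rw [rec_even]
      linear_combination a * b * h_even + a * (a * b) * h_odd -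
        a * α ^ (2 * k) * hα + a * β ^ (2 * k) * hβ
    refine ⟨h_even', ?_⟩
    rw [show 2 * (k + 1) + 1 = 2 * k + 3 by ring, rec_odd]
    linear_combination b * h_even' + a * b * h_odd -
      α ^ (2 * k + 1) * hα + β ^ (2 * k + 1) * hβ

/-- Binet formula for the bi-periodic Fibonacci numbers:
`F n = (a ^ ξ(n+1) / (ab) ^ ⌊n/2⌋) * (α ^ n - β ^ n) / (α - β)`. -/
theorem biF_binet (a b : ℝ) (hab : 0 < a * b) (α β : ℝ)
    (hα : α = (a * b + Real.sqrt ((a * b) ^ 2 + 4 * (a * b))) / 2)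
    (hβ : β = (a * b - Real.sqrt ((a * b) ^ 2 + 4 * (a * b))) / 2)
    (n : ℕ) :
    biF a b n = a ^ xi (n + 1) / (a * b) ^ (n / 2) * ((α ^ n - β ^ n) / (α - β)) := by
  have h_sqrt : Real.sqrt ((a * b) ^ 2 + 4 * (a * b)) ^ 2 = (a * b) ^ 2 + 4 * (a * b) :=
    Real.sq_sqrt (by positivity)
  have h_pos : 0 < Real.sqrt ((a * b) ^ 2 + 4 * (a * b)) := Real.sqrt_pos.2 (by positivity)
  have h_ne : α - β ≠ 0 := by
    rw [hα, hβ]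
    linarith
  have hα_root : α ^ 2 = a * b * α + a * b := by
    rw [hα]
    linear_combination h_sqrt / 4
  have hβ_root : β ^ 2 = a * b * β + a * b := by
    rw [hβ]
    linear_combination h_sqrt / 4
  have h_pow : (a * b) ^ (n / 2) ≠ 0 := pow_ne_zero _ hab.ne'
  obtain ⟨h_even, h_odd⟩ := biF_mul_sub a b α β hα_root hβ_root (n / 2)
  rw [div_mul_div_comm, eq_div_iff (mul_ne_zero h_pow h_ne)]
  rcases Nat.even_or_odd n with hn | hn
  · have hxi : xi (n + 1) = 1 := by grind [xi]
    rw [Nat.two_mul_div_two_of_even hn] at h_even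
    rw [hxi]
    linear_combination h_even
  · have hxi : xi (n + 1) = 0 := by grind [xi]
    rw [Nat.two_mul_div_two_add_one_of_odd hn] at h_odd
    rw [hxi]
    linear_combination h_odd
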